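/- arXiv:2103.01068 — 8 statements merged into one kernel-verified Lean document; each statement's English description precedes it below -/
import Mathlib

section
/- Let n ≥ 1 and equip ℝ^{n+1} with the Minkowski bilinear form Q(x, y) = x₀·y₀ − Σ_{i=1}^{n} x_i·y_i (a symmetric bilinear form of signature (1, n)). Let L be a discrete additive subgroup of ℝ^{n+1}, let w ∈ ℝ^{n+1} satisfy Q(w, w) > 0, and let a > 0. Then the set {M ∈ L : Q(M, M) > 0 and 0 < Q(M, w) ≤ a} is finite. -/
/-- Finiteness of lattice vectors of positive self-intersection and bounded positive
degree with respect to a fixed positive vector, for a bilinear form of signature `(1, n)`. -/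
theorem finite_positive_bounded_degree
    (n : ℕ) (hn : 1 ≤ n)
    (Q : (Fin (n + 1) → ℝ) → (Fin (n + 1) → ℝ) → ℝ)
    (hQ : ∀ x y, Q x y = x 0 * y 0 - ∑ i : Fin n, x i.succ * y i.succ)
    (L : AddSubgroup (Fin (n + 1) → ℝ)) (hL : DiscreteTopology L)
    (w : Fin (n + 1) → ℝ) (hw : 0 < Q w w)
    (a : ℝ) (ha : 0 < a) :
    {M : Fin (n + 1) → ℝ | M ∈ L ∧ 0 < Q M M ∧ 0 < Q M w ∧ Q M w ≤ a}.Finite := by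
  classical
  set q : ℝ := Real.sqrt (∑ i : Fin n, w i.succ * w i.succ) with hq
  have hq0 : 0 ≤ q := Real.sqrt_nonneg _
  have hqq : q ^ 2 = ∑ i : Fin n, w i.succ * w i.succ :=
    Real.sq_sqrt (Finset.sum_nonneg fun i _ => mul_self_nonneg _)
  have hd : 0 < |w 0| - q := by
    rw [hQ, ← hqq] at hw
    have : q < |w 0| := by
      apply lt_of_pow_lt_pow_left₀ 2 (abs_nonneg _)
      rw [sq_abs]; nlinarith
    linarith
  have hcl : IsClosed (L : Set (Fin (n + 1) → ℝ)) := AddSubgroup.isClosed_of_discrete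
  have hfin : (Metric.closedBall (0 : Fin (n + 1) → ℝ) (a / (|w 0| - q)) ∩
      (L : Set (Fin (n + 1) → ℝ))).Finite :=
    Metric.finite_isBounded_inter_isClosed hL.isDiscrete Metric.isBounded_closedBall hcl
  refine hfin.subset ?_
  rintro M ⟨hM, h1, h2, h3⟩
  refine ⟨?_, hM⟩
  rw [hQ] at h1 h2 h3
  set m := |M 0| with hm
  have hm0 : 0 ≤ m := abs_nonneg _
  have hmm : m ^ 2 = M 0 * M 0 := by rw [hm, sq_abs, sq]
  have hS : |∑ i : Fin n, M i.succ * w i.succ| ≤ m * q := by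
    apply abs_le_of_sq_le_sq _ (by positivity)
    have := Finset.sum_mul_sq_le_sq_mul_sq Finset.univ (fun i : Fin n => M i.succ)
      (fun i : Fin n => w i.succ)
    simp only [sq (M _), sq (w _)] at this
    refine this.trans ?_
    rw [mul_pow, hqq, hmm]
    exact mul_le_mul_of_nonneg_right (by linarith)
      (Finset.sum_nonneg fun i _ => mul_self_nonneg _)
  have hbound : m ≤ a / (|w 0| - q) := by
    rw [le_div_iff₀ hd]
    have h4 : |M 0 * w 0| ≤ a + m * q := by
      have := abs_le.mp hS
      rw [abs_le]; constructor <;> linarith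
    rw [abs_mul] at h4
    linarith
  rw [mem_closedBall_zero_iff, pi_norm_le_iff_of_nonneg (hm0.trans hbound)]
  intro i
  refine le_trans ?_ hbound
  rw [Real.norm_eq_abs]
  refine Fin.cases le_rfl (fun j => ?_) i
  apply abs_le_of_sq_le_sq _ hm0
  have := Finset.single_le_sum (f := fun i : Fin n => M i.succ * M i.succ)
    (fun i _ => mul_self_nonneg _) (Finset.mem_univ j)
  rw [hmm, sq]; linarith
end

section
/- Let H2 > 0, b ∈ ℝ and c > 0 be real numbers, and let (r_v, d_v, s_v), (r_w, d_w, s_w) ∈ ℝ³. Then Re Z(r_w,d_w,s_w)·Im Z(r_v,d_v,s_v) − Re Z(r_v,d_v,s_v)·Im Z(r_w,d_w,s_w) = 0 if and only if the determinant of the 3×3 matrix with rows (b² + c², s_w, s_v), (2·b, d_w, d_v), (2/H2, r_w, r_v) vanishes. -/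
/-- The determinantal equation of the numerical wall `W^H_v(w)`: the central charges
`Z(v)` and `Z(w)` are ℝ-colinear iff the 3×3 determinant vanishes. -/
theorem wall_determinantal_equation
    (H2 b c : ℝ) (hH2 : 0 < H2) (hc : 0 < c)
    (rv dv sv rw dw sw : ℝ) :
    ((-sw + dw * b - rw * H2 / 2 * (b ^ 2 - c ^ 2)) * ((dv - rv * H2 * b) * c) -
        (-sv + dv * b - rv * H2 / 2 * (b ^ 2 - c ^ 2)) * ((dw - rw * H2 * b) * c) = 0) ↔
      Matrix.det !![b ^ 2 + c ^ 2, sw, sv; 2 * b, dw, dv; 2 / H2, rw, rv] = 0 := by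
  have key : (-sw + dw * b - rw * H2 / 2 * (b ^ 2 - c ^ 2)) * ((dv - rv * H2 * b) * c) -
        (-sv + dv * b - rv * H2 / 2 * (b ^ 2 - c ^ 2)) * ((dw - rw * H2 * b) * c) =
      (-(c * H2 / 2)) *
        Matrix.det !![b ^ 2 + c ^ 2, sw, sv; 2 * b, dw, dv; 2 / H2, rw, rv] := by
    have hne : H2 ≠ 0 := hH2.ne'
    simp [Matrix.det_fin_three]
    field_simp
    ring
  have hk : -(c * H2 / 2) ≠ 0 := by
    have : 0 < c * H2 / 2 := by positivity
    exact neg_ne_zero.mpr this.ne'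
  simp only [key, mul_eq_zero, hk, false_or]
end

section
/- Let H2 > 0 and KH, τ ∈ ℝ with (KH)² > 2·H2·τ. For a triple v = (r_v, d_v, s_v) ∈ ℝ³ let D_v(b, c) be the determinant of the 3×3 matrix with rows (b² + c², τ/2, s_v), (2·b, −KH, d_v), (2/H2, 2, r_v). Suppose v = (r_v, d_v, s_v) and v' = (r_{v'}, d_{v'}, s_{v'}) are triples such that the three vectors (s_v, d_v, r_v), (s_{v'}, d_{v'}, r_{v'}) and (τ/2, −KH, 2) are linearly independent in ℝ³. Then there is no point (b, c) with c > 0 satisfying both D_v(b, c) = 0 and D_{v'}(b, c) = 0. -/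
/-- Two distinct numerical walls for `Θ_X[1]` in the half-plane `Π_H` do not intersect. -/
theorem distinct_walls_disjoint
    (H2 KH τ : ℝ) (hH2 : 0 < H2) (hdisc : KH ^ 2 > 2 * H2 * τ)
    (rv dv sv rv' dv' sv' : ℝ)
    (hindep : LinearIndependent ℝ
      ![(![sv, dv, rv] : Fin 3 → ℝ), ![sv', dv', rv'], ![τ / 2, -KH, 2]]) :
    ¬ ∃ b c : ℝ, 0 < c ∧
      Matrix.det !![b ^ 2 + c ^ 2, τ / 2, sv; 2 * b, -KH, dv; 2 / H2, 2, rv] = 0 ∧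
      Matrix.det !![b ^ 2 + c ^ 2, τ / 2, sv'; 2 * b, -KH, dv'; 2 / H2, 2, rv'] = 0 := by
  rintro ⟨b, c, hc, h1, h2⟩
  have hu : IsUnit (Matrix.of
      ![(![sv, dv, rv] : Fin 3 → ℝ), ![sv', dv', rv'], ![τ / 2, -KH, 2]]) :=
    Matrix.linearIndependent_rows_iff_isUnit.mp hindep
  have hD := ((Matrix.isUnit_iff_isUnit_det _).mp hu).ne_zero
  have hk : H2 * (2 / H2) = 2 := by field_simp
  generalize 2 / H2 = k at h1 h2 hk
  simp [Matrix.det_fin_three] at h1 h2 hD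
  have n1 : 4 * b + KH * k = 0 := by
    refine (mul_eq_zero.mp ?_).resolve_right hD
    linear_combination (dv' * 2 + rv' * KH) * h1 - (dv * 2 + rv * KH) * h2
  have n2 : k * τ / 2 - (b ^ 2 + c ^ 2) * 2 = 0 := by
    refine (mul_eq_zero.mp ?_).resolve_right hD
    linear_combination (rv' * τ / 2 - sv' * 2) * h1 - (rv * τ / 2 - sv * 2) * h2
  have e1 : KH = -(2 * b * H2) := by linear_combination (H2 * n1 - KH * hk) / 2
  have e2 : τ = 2 * H2 * (b ^ 2 + c ^ 2) := by linear_combination H2 * n2 - τ / 2 * hk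
  rw [e1, e2] at hdisc
  have : 0 < H2 ^ 2 * c ^ 2 := by positivity
  nlinarith
end

section
/- Let H2 > 0, KH > 0 and τ ∈ ℝ, and let b, c be real numbers with −KH/(2·H2) < b < 0 and c > 0. Then ((H2/2)·(c² − b²))/(−H2·b·c) < (τ/2 + KH·b + H2·(b² − c²))/((KH + 2·H2·b)·c) if and only if (b + τ/(2·KH))² + c² < (τ/(2·KH))². -/
/-- In the strip `−K_X·H/(2H²) < b < 0`, `c > 0`, the phase of `O_X` exceeds the phase of
`Θ_X[1]` (expressed via cotangents of the central charges) exactly inside the semicircle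
`C_H` centered at `−τ_X/(2K_X·H)` of radius `τ_X/(2K_X·H)`. -/
theorem phase_comparison_semicircle
    (H2 KH τ : ℝ) (hH2 : 0 < H2) (hKH : 0 < KH)
    (b c : ℝ) (hb1 : -KH / (2 * H2) < b) (hb2 : b < 0) (hc : 0 < c) :
    (H2 / 2 * (c ^ 2 - b ^ 2)) / (-(H2 * b * c)) <
        (τ / 2 + KH * b + H2 * (b ^ 2 - c ^ 2)) / ((KH + 2 * H2 * b) * c) ↔
      (b + τ / (2 * KH)) ^ 2 + c ^ 2 < (τ / (2 * KH)) ^ 2 := by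
  have h1 : 0 < KH + 2 * H2 * b := by
    rw [div_lt_iff₀ (by positivity)] at hb1
    linarith
  have h2 : 0 < -(H2 * b * c) := by
    have := mul_pos (mul_pos hH2 (neg_pos.mpr hb2)) hc
    linarith
  rw [div_lt_div_iff₀ h2 (mul_pos h1 hc)]
  obtain ⟨t, ht⟩ : ∃ t, t = τ / (2 * KH) := ⟨_, rfl⟩
  have hτ : τ = 2 * KH * t := by
    rw [ht]
    field_simp
  rw [← ht, hτ, ← sub_neg, ← sub_neg (b := t ^ 2)]
  have key : H2 / 2 * (c ^ 2 - b ^ 2) * ((KH + 2 * H2 * b) * c) -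
      (2 * KH * t / 2 + KH * b + H2 * (b ^ 2 - c ^ 2)) * -(H2 * b * c) =
      (H2 * c * KH / 2) * ((b + t) ^ 2 + c ^ 2 - t ^ 2) := by ring
  have hp : 0 < H2 * c * KH / 2 := by positivity
  rw [key]
  exact ⟨fun h => by by_contra h0; exact absurd h (not_lt.mpr (mul_nonneg hp.le (not_lt.mp h0))),
    fun h => mul_neg_of_pos_of_neg hp h⟩
end

section
/- Let H2 > 0, c > 0, b ∈ ℝ, and let KH, τ, rF, c1FH, ch2F be real numbers satisfying KH + 2·H2·b > 0, rF > 0, c1FH − rF·H2·b < 0, and N := rF·KH + 2·c1FH > 0. Set b_E = −(rF·τ/2 − 2·ch2F)/N and ρ_E = b_E² + (τ·c1FH + 2·KH·ch2F)/(H2·N). Then (τ/2 + KH·b + H2·(b² − c²))/((KH + 2·H2·b)·c) < (ch2F − c1FH·b + (rF·H2/2)·(b² − c²))/((−c1FH + rF·H2·b)·c) if and only if (b − b_E)² + c² < ρ_E. -/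
/-- The destabilizing region of the exact sequence `0 → E → Θ_X[1] → F_E[1] → 0` is the
interior of the semicircular wall `W_E(Θ_X[1])` with center `b_{E,H}` and squared radius
`r²_{E,H}`. -/
theorem destabilizing_region_semicircle
    (H2 c b KH τ rF c1FH ch2F : ℝ)
    (hH2 : 0 < H2) (hc : 0 < c)
    (hIm : KH + 2 * H2 * b > 0) (hrF : 0 < rF)
    (hF : c1FH - rF * H2 * b < 0)
    (hN : rF * KH + 2 * c1FH > 0) :
    (τ / 2 + KH * b + H2 * (b ^ 2 - c ^ 2)) / ((KH + 2 * H2 * b) * c) <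
        (ch2F - c1FH * b + rF * H2 / 2 * (b ^ 2 - c ^ 2)) / ((-c1FH + rF * H2 * b) * c) ↔
      (b - -(rF * τ / 2 - 2 * ch2F) / (rF * KH + 2 * c1FH)) ^ 2 + c ^ 2 <
        (-(rF * τ / 2 - 2 * ch2F) / (rF * KH + 2 * c1FH)) ^ 2 +
          (τ * c1FH + 2 * KH * ch2F) / (H2 * (rF * KH + 2 * c1FH)) := by
  have hE : 0 < -c1FH + rF * H2 * b := by linarith
  have hD : 0 < KH + 2 * H2 * b := hIm
  have hN' : 0 < rF * KH + 2 * c1FH := hN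
  have hk : 0 < 2 / (H2 * (rF * KH + 2 * c1FH)) := by positivity
  have key : (b - -(rF * τ / 2 - 2 * ch2F) / (rF * KH + 2 * c1FH)) ^ 2 + c ^ 2 -
        ((-(rF * τ / 2 - 2 * ch2F) / (rF * KH + 2 * c1FH)) ^ 2 +
          (τ * c1FH + 2 * KH * ch2F) / (H2 * (rF * KH + 2 * c1FH))) =
      2 / (H2 * (rF * KH + 2 * c1FH)) *
        ((τ / 2 + KH * b + H2 * (b ^ 2 - c ^ 2)) * (-c1FH + rF * H2 * b) -
          (ch2F - c1FH * b + rF * H2 / 2 * (b ^ 2 - c ^ 2)) * (KH + 2 * H2 * b)) := by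
    have h1 := hN'.ne'
    have h2 := hH2.ne'
    generalize hn : rF * KH + 2 * c1FH = n at h1 ⊢
    field_simp
    subst hn
    ring
  have hm : ∀ k x : ℝ, 0 < k → (k * x < 0 ↔ x < 0) := fun k x hk =>
    ⟨fun h => (pos_iff_neg_of_mul_neg h).1 hk, mul_neg_of_pos_of_neg hk⟩
  rw [← sub_neg (a := (b - _) ^ 2 + c ^ 2), key, hm _ _ hk, sub_neg,
    ← div_div, ← div_div, div_lt_div_iff_of_pos_right hc, div_lt_div_iff₀ hD hE]
end

section
/- Let n ≥ 1 be a natural number, h2 > 0 a real number, and r, d, t : Fin n → ℝ functions satisfying: r i > 0 for all i; d i ≥ 0 for all i; d i · r 0 ≤ d 0 · r i for all i; and t i ≤ (d i)²/(h2 · r i) for all i ≠ 0. Then, writing D = Σ_i d i and T = Σ_i t i, one has D² − h2·(r 0)·T ≥ (d 0)² − h2·(r 0)·(t 0). -/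
/-- Bogomolov–Gieseker type inequality for unstable torsion free sheaves (numerical form):
`(c₁(E)·h)² − 2h²·ch₀(Q₀)·ch₂(E) ≥ Δ^h(Q₀)`. -/
theorem BG_inequality_unstable
    (n : ℕ) (hn : 1 ≤ n) (h2 : ℝ) (hh2 : 0 < h2)
    (r d t : Fin n → ℝ)
    (hr : ∀ i, 0 < r i)
    (hd : ∀ i, 0 ≤ d i)
    (hslope : ∀ i, d i * r ⟨0, hn⟩ ≤ d ⟨0, hn⟩ * r i)
    (hBG : ∀ i, i ≠ ⟨0, hn⟩ → t i ≤ (d i) ^ 2 / (h2 * r i)) :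
    (∑ i, d i) ^ 2 - h2 * r ⟨0, hn⟩ * (∑ i, t i) ≥
      (d ⟨0, hn⟩) ^ 2 - h2 * r ⟨0, hn⟩ * t ⟨0, hn⟩ := by
  generalize (⟨0, hn⟩ : Fin n) = z at *
  have key : ∀ i ∈ Finset.univ.erase z, h2 * r z * t i ≤ d z * d i := by
    intro i hi
    have h1 := hBG i (Finset.ne_of_mem_erase hi)
    have hri := hr i
    rw [le_div_iff₀ (mul_pos hh2 hri)] at h1
    have h3 := mul_le_mul_of_nonneg_left h1 (hr z).le
    have h4 := mul_le_mul_of_nonneg_left (hslope i) (hd i)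
    refine le_of_mul_le_mul_right ?_ hri
    nlinarith
  have hsum := Finset.sum_le_sum key
  rw [← Finset.mul_sum, ← Finset.mul_sum] at hsum
  have hS : 0 ≤ ∑ i ∈ Finset.univ.erase z, d i := Finset.sum_nonneg fun i _ => hd i
  rw [← Finset.add_sum_erase _ d (Finset.mem_univ z),
    ← Finset.add_sum_erase _ t (Finset.mem_univ z)]
  nlinarith [mul_nonneg (hd z) hS, mul_nonneg hS hS]
end

section
/- Let c2, K2, χ be positive integers with K2 + c2 = 12·χ, K2 > 2·c2, K2 ≤ 9·χ, and 2·(3·c2 − K2) < Real.sqrt (K2 : ℝ). Then 8·c2 < 3·K2. -/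
/-- For a minimal surface of general type with positive index and
`3c₂ − K² < (1/2)·√(K²)`, the Chern ratio `α_X = c₂/K²` is less than `3/8`. -/
theorem small_distance_implies_small_ratio
    (c2 K2 χ : ℤ) (hc2 : 0 < c2) (hK2 : 0 < K2) (hχ : 0 < χ)
    (hNoether : K2 + c2 = 12 * χ)
    (hindex : K2 > 2 * c2)
    (hBMY : K2 ≤ 9 * χ)
    (hsmall : ((2 * (3 * c2 - K2) : ℤ) : ℝ) < Real.sqrt (K2 : ℝ)) :
    8 * c2 < 3 * K2 := by
  by_contra hcon
  have hd : 0 < 3 * c2 - K2 := by omega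
  have h1 : (((2 * (3 * c2 - K2) : ℤ) : ℝ)) ^ 2 < (K2 : ℝ) := by
    refine (Real.lt_sqrt ?_).1 hsmall
    exact_mod_cast (by omega : (0 : ℤ) ≤ 2 * (3 * c2 - K2))
  have h2 : (2 * (3 * c2 - K2)) ^ 2 < K2 := by exact_mod_cast h1
  have h3 : K2 ≤ 8 * (3 * c2 - K2) := by omega
  have h4 : 3 * c2 - K2 < 2 := by nlinarith
  omega
end

section
/- Let K2, q, d, e be integers with K2 ≥ 9, q ≥ 4, d ≥ 0, e·K2 ≤ d², d ≤ 4·q, d − 2·e ≤ q, and 2·q < Real.sqrt (K2 : ℝ). Then d ≤ 2·q. -/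
/-- Numerical core of the bound `C_X·K_X ≤ 2(3c₂ − K²)` for surfaces with small
`3c₂ − K²`: here `d = C_X·K_X`, `e = C²_X` and `q = 3c₂ − K²`. -/
theorem CX_degree_bound
    (K2 q d e : ℤ)
    (hK2 : K2 ≥ 9) (hq : q ≥ 4) (hd : d ≥ 0)
    (hHodge : e * K2 ≤ d ^ 2)
    (hd4q : d ≤ 4 * q)
    (hBGM : d - 2 * e ≤ q)
    (hsmall : ((2 * q : ℤ) : ℝ) < Real.sqrt (K2 : ℝ)) :
    d ≤ 2 * q := by
  have hK : (2 * q) ^ 2 < K2 := by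
    have h0 : (0 : ℝ) ≤ ((2 * q : ℤ) : ℝ) := by
      exact_mod_cast (by omega : (0 : ℤ) ≤ 2 * q)
    have h1 := (Real.lt_sqrt h0).1 hsmall
    exact_mod_cast h1
  by_contra! hc
  have he3 : 3 ≤ e := by omega
  have he4 : e < 4 := by
    by_contra! h
    have h1 : 4 * K2 ≤ e * K2 := mul_le_mul_of_nonneg_right h (by omega)
    have h2 : d ^ 2 ≤ (4 * q) ^ 2 := pow_le_pow_left₀ hd hd4q 2
    nlinarith
  have he : e = 3 := by omega
  subst he
  have hq5 : q ≤ 5 := by omega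
  have hd11 : d ≤ 11 := by omega
  nlinarith
end
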